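/- arXiv:2510.05999 — 2 statements merged into one kernel-verified Lean document; each statement's English description precedes it below -/
import Mathlib

section
/- Let $N\ge3$, $\gamma>1$ and $q\in[2,2_*]$, where $2_*=\frac{2(N-1)}{N-2}$. Then there exists a constant $C>0$, depending only on $N$, $\gamma$ and $q$, such that for every $u\in C_c^\infty(\mathbb{R}^N)$, $\left(\int_{\mathbb{R}^{N-1}}|u(x',0)|^q\,dx'\right)^{2/q}\le C\int_{\mathbb{R}^N_+}(1+x_N)^{\gamma}|\nabla u(x)|^2\,dx$. -/
open MeasureTheory Filter
open scoped Topology ENNReal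

noncomputable section

/-- The last coordinate of a point of `ℝ^N`. -/
def xN (N : ℕ) (hN : 0 < N) (x : EuclideanSpace ℝ (Fin N)) : ℝ :=
  x ⟨N - 1, Nat.sub_lt hN Nat.one_pos⟩

/-- The open upper half-space `ℝ^N₊`. -/
def Hplus (N : ℕ) (hN : 0 < N) : Set (EuclideanSpace ℝ (Fin N)) :=
  {x | 0 < xN N hN x}

/-- The point `(y, t) ∈ ℝ^N` with horizontal part `y ∈ ℝ^(N-1)` and last coordinate `t`. -/
def mkPt (N : ℕ) (y : EuclideanSpace ℝ (Fin (N - 1))) (t : ℝ) :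
    EuclideanSpace ℝ (Fin N) :=
  (WithLp.equiv 2 (Fin N → ℝ)).symm fun i => if h : (i : ℕ) < N - 1 then y ⟨(i : ℕ), h⟩ else t

/-- The boundary point `(y, 0)`. -/
def bPt (N : ℕ) (y : EuclideanSpace ℝ (Fin (N - 1))) : EuclideanSpace ℝ (Fin N) :=
  mkPt N y 0

/-- Partial derivative of `u` in the `i`-th coordinate direction. -/
def pd (N : ℕ) (u : EuclideanSpace ℝ (Fin N) → ℝ) (i : Fin N)
    (x : EuclideanSpace ℝ (Fin N)) : ℝ :=
  fderiv ℝ u x (EuclideanSpace.single i 1)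

/-- `div (w ∇u)` written as a sum of coordinate partial derivatives. -/
def divW (N : ℕ) (w u : EuclideanSpace ℝ (Fin N) → ℝ)
    (x : EuclideanSpace ℝ (Fin N)) : ℝ :=
  ∑ i, pd N (fun z => w z * pd N u i z) i x


section aux

def ptEquiv (N : ℕ) (hN : 0 < N) : (EuclideanSpace ℝ (Fin (N - 1)) × ℝ) ≃ᵐ EuclideanSpace ℝ (Fin N) where
  toFun p := mkPt N p.1 p.2
  invFun x := (WithLp.toLp 2 fun i => x ⟨i, by omega⟩, xN N hN x)
  left_inv := by
    rintro ⟨y, t⟩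
    ext i <;> simp [mkPt, xN]
  right_inv := by
    intro x
    ext i
    simp only [mkPt, xN]
    by_cases h : (i:ℕ) < N - 1
    · simp [h]
    · have : i = ⟨N-1, by omega⟩ := by ext; simp; omega
      simp [this]
  measurable_toFun := by
    simp only [Equiv.coe_fn_mk]
    unfold mkPt
    refine (WithLp.measurable_toLp 2 _).comp ?_
    refine measurable_pi_iff.2 fun i => ?_
    by_cases h : (i:ℕ) < N - 1
    · simp only [h, dite_true]; fun_prop
    · simp only [h, dite_false]; fun_prop
  measurable_invFun := by
    simp only [Equiv.coe_fn_symm_mk]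
    unfold xN
    fun_prop

lemma ptEquiv_mp (N : ℕ) (hN : 0 < N) : MeasurePreserving (ptEquiv N hN) volume volume := by
  obtain ⟨n, rfl⟩ : ∃ n, N = n + 1 := ⟨N - 1, by omega⟩
  have h1 := (volume_preserving_piFinSuccAbove (fun _ : Fin (n+1) => ℝ) (Fin.last n)).symm
  have h2 := PiLp.volume_preserving_toLp (Fin (n+1))
  have h3 := PiLp.volume_preserving_ofLp (Fin n)
  have h4 := (Measure.measurePreserving_swap (μ := (volume : Measure (Fin n → ℝ))) (ν := (volume : Measure ℝ)))
  have h5 := h3.prod (MeasurePreserving.id (volume : Measure ℝ))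
  have h6 := h2.comp (h1.comp (h4.comp h5))
  have key : (ptEquiv (n+1) hN : _ → EuclideanSpace ℝ (Fin (n+1))) = (WithLp.toLp 2) ∘
     ((MeasurableEquiv.piFinSuccAbove (fun _ : Fin (n+1) => ℝ) (Fin.last n)).symm ∘ (Prod.swap ∘ Prod.map (WithLp.ofLp) id)) := ?_
  · rw [key]; exact h6
  ext ⟨y, t⟩ i
  simp [ptEquiv, mkPt]
  rcases Fin.eq_castSucc_or_eq_last i with ⟨j, rfl⟩ | rfl
  · simp
  · simp


lemma mkPt_xN (N : ℕ) (hN : 0 < N) (y : EuclideanSpace ℝ (Fin (N - 1))) (t : ℝ) :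
    xN N hN (mkPt N y t) = t := by
  simp [mkPt, xN]

lemma Hplus_meas (N : ℕ) (hN : 0 < N) : MeasurableSet (Hplus N hN) := by
  unfold Hplus xN
  exact measurableSet_lt measurable_const (by fun_prop)

lemma int_prod (N : ℕ) (hN : 0 < N) (F : EuclideanSpace ℝ (Fin N) → ℝ)
    (hF : Integrable F) : ∫ x, F x = ∫ y, ∫ t, F (mkPt N y t) := by
  have hmp := ptEquiv_mp N hN
  rw [← hmp.integral_comp (ptEquiv N hN).measurableEmbedding]
  have := (hmp.integrable_comp_emb (ptEquiv N hN).measurableEmbedding).2 hF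
  exact integral_prod _ this

lemma int_H_aux (N : ℕ) (hN : 0 < N) (F : EuclideanSpace ℝ (Fin N) → ℝ)
    (hF : Integrable F) : 
    Integrable (fun y => ∫ t in Set.Ioi (0:ℝ), F (mkPt N y t)) ∧
    ∫ x in Hplus N hN, F x = ∫ y, ∫ t in Set.Ioi (0:ℝ), F (mkPt N y t) := by
  have hmp := ptEquiv_mp N hN
  have hi := (hmp.integrable_comp_emb (ptEquiv N hN).measurableEmbedding).2 hF
  have hpre : (ptEquiv N hN) ⁻¹' (Hplus N hN) = Set.univ ×ˢ Set.Ioi 0 := by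
    ext ⟨y, t⟩
    have : ptEquiv N hN (y, t) = mkPt N y t := rfl
    simp [Hplus, this, mkPt_xN]
  have hi2 : IntegrableOn (F ∘ ptEquiv N hN) (Set.univ ×ˢ Set.Ioi 0) 
    ((volume : Measure (EuclideanSpace ℝ (Fin (N-1)))).prod (volume : Measure ℝ)) := hi.integrableOn
  constructor
  · have h3 := hi2
    rw [IntegrableOn, ← Measure.prod_restrict, Measure.restrict_univ] at h3
    exact h3.integral_prod_left
  · rw [← hmp.setIntegral_preimage_emb (ptEquiv N hN).measurableEmbedding, hpre]
    have := setIntegral_prod _ hi2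
    rw [Measure.restrict_univ] at this
    exact this

/-- smoothed even reflection -/
def Ph (N : ℕ) (hN : 0 < N) (ε : ℝ) (x : EuclideanSpace ℝ (Fin N)) : EuclideanSpace ℝ (Fin N) :=
  x + (√(ε ^ 2 + xN N hN x ^ 2) - xN N hN x) • EuclideanSpace.single ⟨N - 1, Nat.sub_lt hN Nat.one_pos⟩ (1:ℝ)

lemma Ph_zero (N : ℕ) (hN : 0 < N) (y : EuclideanSpace ℝ (Fin (N - 1))) (t : ℝ) :
    Ph N hN 0 (mkPt N y t) = mkPt N y |t| := by
  unfold Ph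
  rw [mkPt_xN]
  ext i
  by_cases h : (i:ℕ) < N - 1
  · have : i ≠ ⟨N-1, Nat.sub_lt hN Nat.one_pos⟩ := by rintro rfl; simp at h
    simp [mkPt, h, this]
  · have : i = ⟨N-1, Nat.sub_lt hN Nat.one_pos⟩ := by ext; simp; omega
    subst this
    simp [mkPt, Real.sqrt_sq_eq_abs]

lemma Ph_norm (N : ℕ) (hN : 0 < N) (ε : ℝ) (x : EuclideanSpace ℝ (Fin N)) :
    ‖x‖ ≤ ‖Ph N hN ε x‖ := by
  rw [EuclideanSpace.norm_eq, EuclideanSpace.norm_eq]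
  refine Real.sqrt_le_sqrt (Finset.sum_le_sum fun i _ => ?_)
  by_cases h : i = ⟨N-1, Nat.sub_lt hN Nat.one_pos⟩
  · subst h
    simp [Ph, xN]
    rw [Real.sq_sqrt (by positivity)]
    nlinarith [sq_nonneg ε]
  · simp [Ph, h]

lemma Ph_cont (N : ℕ) (hN : 0 < N) : Continuous (fun p : ℝ × EuclideanSpace ℝ (Fin N) => Ph N hN p.1 p.2) := by
  unfold Ph xN
  fun_prop

lemma comp_int (N : ℕ) (hN : 0 < N) (F : EuclideanSpace ℝ (Fin N) → ℝ)
    (hF : Continuous F) (hc : HasCompactSupport F) :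
    ∃ G : EuclideanSpace ℝ (Fin N) → ℝ, Integrable G ∧ ∀ ε x, ‖F (Ph N hN ε x)‖ ≤ G x := by
  obtain ⟨M, hM⟩ := hF.bounded_above_of_compact_support hc
  obtain ⟨R, hR⟩ := hc.isCompact.isBounded.subset_closedBall 0
  refine ⟨(Metric.closedBall 0 R).indicator fun _ => M, ?_, ?_⟩
  · rw [integrable_indicator_iff Metric.isClosed_closedBall.measurableSet]
    exact integrableOn_const (isCompact_closedBall _ _).measure_lt_top.ne
  · intro ε x
    by_cases hx : x ∈ Metric.closedBall 0 R
    · rw [Set.indicator_of_mem hx]; exact hM _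
    · rw [Set.indicator_of_notMem hx]
      have : Ph N hN ε x ∉ tsupport F := by
        intro h
        have := hR h
        simp at this hx
        linarith [Ph_norm N hN ε x]
      rw [image_eq_zero_of_notMem_tsupport this]; simp

lemma comp_lim (N : ℕ) (hN : 0 < N) (F : EuclideanSpace ℝ (Fin N) → ℝ)
    (hF : Continuous F) (hc : HasCompactSupport F) :
    Tendsto (fun ε => ∫ x, F (Ph N hN ε x)) (𝓝[>] 0) (𝓝 (2 * ∫ x in Hplus N hN, F x)) := by
  obtain ⟨G, hG, hFG⟩ := comp_int N hN F hF hc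
  have hcont : Continuous (fun p : ℝ × EuclideanSpace ℝ (Fin N) => F (Ph N hN p.1 p.2)) :=
    hF.comp (Ph_cont N hN)
  have h0 : Integrable (fun x => F (Ph N hN 0 x)) :=
    hG.mono' (hcont.comp (Continuous.prodMk_right 0)).aestronglyMeasurable (Eventually.of_forall fun x => hFG 0 x)
  have : 2 * ∫ x in Hplus N hN, F x = ∫ x, F (Ph N hN 0 x) := by
    rw [int_prod N hN _ h0, (int_H_aux N hN F (hF.integrable_of_hasCompactSupport hc)).2,
      ← integral_const_mul]
    congr 1
    ext y
    simp_rw [Ph_zero]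
    exact (integral_comp_abs (f := fun t => F (mkPt N y t))).symm
  rw [this]
  apply tendsto_integral_filter_of_dominated_convergence G
  · exact Eventually.of_forall fun ε => (hcont.comp (Continuous.prodMk_right ε)).aestronglyMeasurable
  · exact Eventually.of_forall fun ε => Eventually.of_forall fun x => hFG ε x
  · exact hG
  · refine Eventually.of_forall fun x => ?_
    exact ((hcont.comp (Continuous.prodMk_left x)).tendsto 0).mono_left nhdsWithin_le_nhds

lemma Ph_contDiff (N : ℕ) (hN : 0 < N) (ε : ℝ) (hε : 0 < ε) : ContDiff ℝ 1 (Ph N hN ε) := by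
  unfold Ph xN
  refine contDiff_id.add (ContDiff.smul (ContDiff.sub (ContDiff.sqrt ?_ ?_) ?_) contDiff_const)
  · fun_prop
  · intro x; positivity
  · fun_prop

lemma Ph_fderiv (N : ℕ) (hN : 0 < N) (ε : ℝ) (hε : 0 < ε) (x : EuclideanSpace ℝ (Fin N)) : 
    ‖fderiv ℝ (Ph N hN ε) x‖ ≤ 1 := by
  set e : Fin N := ⟨N-1, Nat.sub_lt hN Nat.one_pos⟩ with he
  have hx : HasFDerivAt (fun x => xN N hN x) (EuclideanSpace.proj e : EuclideanSpace ℝ (Fin N) →L[ℝ] ℝ) x :=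
    (EuclideanSpace.proj e : EuclideanSpace ℝ (Fin N) →L[ℝ] ℝ).hasFDerivAt
  have h1 := ((hx.pow 2).const_add (ε ^ 2)).sqrt (by positivity)
  have h2 := (hasFDerivAt_id x).add ((h1.sub hx).smul_const (EuclideanSpace.single e (1:ℝ)))
  have h3 : HasFDerivAt (Ph N hN ε) _ x := h2
  rw [h3.fderiv]
  refine ContinuousLinearMap.opNorm_le_bound _ zero_le_one fun h => ?_
  rw [one_mul, EuclideanSpace.norm_eq, EuclideanSpace.norm_eq]
  refine Real.sqrt_le_sqrt (Finset.sum_le_sum fun i _ => ?_)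
  have hs : |xN N hN x| ≤ √(ε ^ 2 + xN N hN x ^ 2) := Real.abs_le_sqrt (by nlinarith)
  have hs0 : 0 < √(ε ^ 2 + xN N hN x ^ 2) := by positivity
  by_cases hi : i = e
  · subst hi
    simp
    rw [abs_of_pos hs0, show (√(ε ^ 2 + xN N hN x ^ 2))⁻¹ * 2⁻¹ * (2 * |xN N hN x| * |h.ofLp e|) = (|xN N hN x| / √(ε ^ 2 + xN N hN x ^ 2)) * |h.ofLp e| by field_simp]
    rw [← sq_abs (h.ofLp e)]
    have : |xN N hN x| / √(ε ^ 2 + xN N hN x ^ 2) ≤ 1 := by rw [div_le_one hs0]; exact hs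
    gcongr
    exact mul_le_of_le_one_left (abs_nonneg _) this
  · simp [hi]

lemma half_sobolev (N : ℕ) (hN : 3 ≤ N) (hN0 : 0 < N) : ∃ K > (0:ℝ), ∀ u : EuclideanSpace ℝ (Fin N) → ℝ,
      ContDiff ℝ 1 u → HasCompactSupport u →
      ∫ x in Hplus N hN0, |u x| ^ (2 * (N:ℝ) / (N - 2)) ≤ 
       K * (∫ x in Hplus N hN0, ‖fderiv ℝ u x‖ ^ 2) ^ ((N:ℝ) / (N - 2)) := by
  have hN' : (3:ℝ) ≤ N := by exact_mod_cast hN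
  have hN2 : (0:ℝ) < N - 2 := by linarith
  set p' : NNReal := ⟨2 * (N:ℝ) / (N - 2), by positivity⟩ with hp'
  have hp'v : (p':ℝ) = 2 * (N:ℝ) / (N - 2) := rfl
  have hp'0 : (0:ℝ) < p' := by rw [hp'v]; positivity
  set S := SNormLESNormFDerivOfEqConst ℝ (volume : Measure (EuclideanSpace ℝ (Fin N))) ((2:NNReal):ℝ) with hS
  set S' : ℝ := (S:ℝ) + 1 with hS'
  have hS'0 : 0 < S' := by positivity
  have base : ∀ u : EuclideanSpace ℝ (Fin N) → ℝ,
      ContDiff ℝ 1 u → HasCompactSupport u →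
      ∫ x, |u x| ^ (2 * (N:ℝ) / (N - 2)) ≤ S' ^ (2 * (N:ℝ) / (N - 2)) *
       (∫ x, ‖fderiv ℝ u x‖ ^ 2) ^ ((N:ℝ) / (N - 2)) := by
    intro u hu hc
    have h := eLpNorm_le_eLpNorm_fderiv_of_eq (F := ℝ) (volume : Measure (EuclideanSpace ℝ (Fin N))) hu hc (p := 2) (p' := p')
      (by norm_num) (by simp; omega) (by
        rw [hp'v]; simp; field_simp)
    have m1 : MemLp u p' := hu.continuous.memLp_of_hasCompactSupport hc
    have m2 : MemLp (fderiv ℝ u) (2:NNReal) :=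
      (hu.continuous_fderiv one_ne_zero).memLp_of_hasCompactSupport (hc.fderiv ℝ)
    rw [m1.eLpNorm_eq_integral_rpow_norm (by simpa using hp'0.ne') (by simp),
      m2.eLpNorm_eq_integral_rpow_norm (by simp) (by simp)] at h
    rw [← hS] at h
    have hSe : (S : ℝ≥0∞) = ENNReal.ofReal S := by simp
    rw [hSe, ← ENNReal.ofReal_mul (by positivity), ENNReal.ofReal_le_ofReal_iff (by positivity)] at h
    simp only [ENNReal.coe_toReal, Real.norm_eq_abs, NNReal.coe_ofNat, Real.rpow_ofNat] at h
    set A := ∫ x, |u x| ^ (p':ℝ) with hA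
    set B := ∫ x, ‖fderiv ℝ u x‖ ^ 2 with hB
    have hA0 : 0 ≤ A := by positivity
    have hB0 : 0 ≤ B := by positivity
    have h' : A ^ (p':ℝ)⁻¹ ≤ S' * B ^ (2:ℝ)⁻¹ := h.trans (by gcongr; simp [hS'])
    have h2 := Real.rpow_le_rpow (by positivity) h' hp'0.le
    rw [Real.rpow_inv_rpow hA0 hp'0.ne', Real.mul_rpow (by positivity) (by positivity), ← Real.rpow_mul hB0] at h2
    rw [show (2:ℝ)⁻¹ * p' = (N:ℝ) / (N - 2) by rw [hp'v]; field_simp] at h2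
    exact h2
  refine ⟨S' ^ (2 * (N:ℝ) / (N - 2)) * 2 ^ ((N:ℝ) / (N - 2)) / 2, by positivity, fun u hu hc => ?_⟩
  have l1 := comp_lim N hN0 (fun x => |u x| ^ (2 * (N:ℝ) / (N - 2)))
    (by
      refine (hu.continuous.abs).rpow_const fun x => Or.inr (by positivity))
    (hc.comp_left (g := fun t => |t| ^ (2 * (N:ℝ) / (N - 2))) (by
      simp; rw [Real.zero_rpow]; positivity))
  have c2 : Continuous (fun x => ‖fderiv ℝ u x‖ ^ 2) := (hu.continuous_fderiv one_ne_zero).norm.pow 2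
  have s2 : HasCompactSupport (fun x => ‖fderiv ℝ u x‖ ^ 2) := 
    (hc.fderiv ℝ).comp_left (g := fun t => ‖t‖ ^ 2) (by simp)
  have l2 := comp_lim N hN0 (fun x => ‖fderiv ℝ u x‖ ^ 2) c2 s2
  have l3 := (l2.rpow_const (p := (N:ℝ) / (N - 2)) (Or.inr (by positivity))).const_mul (S' ^ (2 * (N:ℝ) / (N - 2)))
  have h := le_of_tendsto_of_tendsto l1 l3 ?_
  · rw [Real.mul_rpow (by norm_num) (by positivity)] at h
    linarith
  · filter_upwards [self_mem_nhdsWithin] with ε hε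
    have hε : 0 < ε := hε
    have hP := Ph_contDiff N hN0 ε hε
    have hcv : HasCompactSupport (u ∘ Ph N hN0 ε) := by
      obtain ⟨R, hR⟩ := hc.isCompact.isBounded.subset_closedBall 0
      refine HasCompactSupport.of_support_subset_isCompact (isCompact_closedBall 0 R) fun x hx => ?_
      have := hR (subset_tsupport u (show Ph N hN0 ε x ∈ Function.support u from hx))
      simp at this ⊢
      exact (Ph_norm N hN0 ε x).trans this
    refine (base (u ∘ Ph N hN0 ε) (hu.comp hP) hcv).trans ?_
    refine mul_le_mul_of_nonneg_left (Real.rpow_le_rpow (by positivity) ?_ (by positivity)) (by positivity)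
    obtain ⟨G, hG, hFG⟩ := comp_int N hN0 _ c2 s2
    refine integral_mono_of_nonneg (Eventually.of_forall fun x => by positivity) ?_ (Eventually.of_forall fun x => ?_)
    · refine hG.mono' ?_ (Eventually.of_forall fun x => hFG ε x)
      exact (c2.comp hP.continuous).aestronglyMeasurable
    · simp only
      gcongr
      rw [fderiv_comp x (hu.differentiable one_ne_zero _) (hP.differentiable one_ne_zero _)]
      refine (ContinuousLinearMap.opNorm_comp_le _ _).trans ?_
      exact mul_le_of_le_one_right (norm_nonneg _) (Ph_fderiv N hN0 ε hε x)

lemma cs_aux {α : Type*} [MeasurableSpace α] (μ : Measure α) (f g : α → ℝ)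
    (hf0 : 0 ≤ᵐ[μ] f) (hg0 : 0 ≤ᵐ[μ] g) (hf : MemLp f 2 μ) (hg : MemLp g 2 μ) :
    ∫ x, f x * g x ∂μ ≤ √(∫ x, f x ^ 2 ∂μ) * √(∫ x, g x ^ 2 ∂μ) := by
  have := integral_mul_le_Lp_mul_Lq_of_nonneg Real.HolderConjugate.two_two hf0 hg0
    (by simpa using hf) (by simpa using hg)
  simpa [Real.sqrt_eq_rpow] using this

lemma line_one (g : ℝ → ℝ) (hg : ContDiff ℝ 1 g) (hc : HasCompactSupport g) :
    |g 0| ≤ ∫ t in Set.Ioi (0:ℝ), |deriv g t| := by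
  have h := hc.integral_Ioi_deriv_eq hg 0
  have h2 := norm_integral_le_integral_norm (μ := volume.restrict (Set.Ioi (0:ℝ))) (deriv g)
  rw [h] at h2
  simpa using h2

lemma line_s (g : ℝ → ℝ) (hg : ContDiff ℝ 1 g) (hc : HasCompactSupport g) (s : ℝ) (hs : 2 ≤ s) :
    |g 0| ^ s ≤ ∫ t in Set.Ioi (0:ℝ), s * (|g t| ^ (s - 1) * |deriv g t|) := by
  have h := line_one (fun t => |g t| ^ s) (hg.norm_rpow (by linarith))
    (hc.comp_left (g := fun t => |t| ^ s) (by simp; rw [Real.zero_rpow]; linarith))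
  rw [abs_of_nonneg (by positivity)] at h
  refine h.trans (le_of_eq ?_)
  congr 1
  ext t
  have h1 := (hasDerivAt_abs_rpow (g t) (p := s) (by linarith)).comp t (hg.differentiable one_ne_zero t).hasDerivAt
  have h2 : deriv (fun t => |g t| ^ s) t = _ := h1.deriv
  rw [h2, abs_mul, abs_mul, abs_mul, abs_of_nonneg (show 0 ≤ s by linarith), abs_of_nonneg (show 0 ≤ |g t| ^ (s-2) by positivity)]
  have : |g t| ^ (s - 1) = |g t| ^ (s - 2) * |g t| := by
    rcases eq_or_ne (g t) 0 with h0 | h0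
    · simp [h0]; rw [Real.zero_rpow]; linarith
    · rw [show s - 1 = (s - 2) + 1 by ring, Real.rpow_add_one (by simpa using h0)]
  rw [this]; ring

lemma line_two (γ : ℝ) (hγ : 1 < γ) : ∃ C > (0:ℝ), ∀ g : ℝ → ℝ, ContDiff ℝ 1 g → HasCompactSupport g →
    |g 0| ^ 2 ≤ C * ∫ t in Set.Ioi (0:ℝ), (1 + t) ^ γ * |deriv g t| ^ 2 := by
  set C0 := ∫ t in Set.Ioi (0:ℝ), (1 + t) ^ (-γ) with hC0
  have hC0n : 0 ≤ C0 := setIntegral_nonneg measurableSet_Ioi fun t ht => by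
    have : (0:ℝ) < t := ht
    positivity
  refine ⟨C0 + 1, by positivity, fun g hg hc => ?_⟩
  have hi : IntegrableOn (fun t : ℝ => (1 + t) ^ (-γ)) (Set.Ioi 0) := by
    have := integrableOn_add_rpow_Ioi_of_lt (a := -γ) (c := 0) (m := 1) (by linarith) (by norm_num)
    simpa [add_comm] using this
  have hcd : Continuous (deriv g) := hg.continuous_deriv le_rfl
  have hcg : Continuous (fun t : ℝ => (1 + t) ^ γ * |deriv g t| ^ 2) :=
    ((continuous_const.add continuous_id).rpow_const fun x => Or.inr (by linarith)).mul (hcd.abs.pow 2)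
  have hsg : HasCompactSupport (fun t : ℝ => (1 + t) ^ γ * |deriv g t| ^ 2) :=
    HasCompactSupport.mul_left (hc.deriv.comp_left (g := fun t => |t| ^ 2) (by simp))
  have hig : IntegrableOn (fun t : ℝ => (1 + t) ^ γ * |deriv g t| ^ 2) (Set.Ioi 0) :=
    (hcg.integrable_of_hasCompactSupport hsg).integrableOn
  have e1 : ∀ t ∈ Set.Ioi (0:ℝ), ((1 + t) ^ (-γ/2)) ^ 2 = (1 + t) ^ (-γ) := fun t ht => by
    have : (0:ℝ) < t := ht
    rw [← Real.rpow_mul_natCast (by positivity)]; congr 1; push_cast; ring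
  have e2 : ∀ t ∈ Set.Ioi (0:ℝ), ((1 + t) ^ (γ/2) * |deriv g t|) ^ 2 = (1 + t) ^ γ * |deriv g t| ^ 2 := fun t ht => by
    have : (0:ℝ) < t := ht
    rw [mul_pow, ← Real.rpow_mul_natCast (by positivity)]; congr 2; push_cast; ring
  have e3 : ∀ t ∈ Set.Ioi (0:ℝ), (1 + t) ^ (-γ/2) * ((1 + t) ^ (γ/2) * |deriv g t|) = |deriv g t| := fun t ht => by
    have : (0:ℝ) < t := ht
    rw [← mul_assoc, ← Real.rpow_add (by positivity)]; 
    rw [show -γ/2 + γ/2 = 0 by ring]; simp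
  have m1 : MemLp (fun t : ℝ => (1 + t) ^ (-γ/2)) 2 (volume.restrict (Set.Ioi 0)) := by
    have hm : AEStronglyMeasurable (fun t : ℝ => (1 + t) ^ (-γ/2)) (volume.restrict (Set.Ioi 0)) :=
      Measurable.aestronglyMeasurable ((measurable_const.add measurable_id).pow_const _)
    rw [memLp_two_iff_integrable_sq hm]
    exact hi.congr_fun (fun t ht => (e1 t ht).symm) measurableSet_Ioi
  have m2 : MemLp (fun t : ℝ => (1 + t) ^ (γ/2) * |deriv g t|) 2 (volume.restrict (Set.Ioi 0)) := by
    rw [memLp_two_iff_integrable_sq (by fun_prop)]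
    exact hig.congr_fun (fun t ht => (e2 t ht).symm) measurableSet_Ioi
  have hcs := cs_aux (volume.restrict (Set.Ioi 0)) _ _ (by
      filter_upwards [self_mem_ae_restrict measurableSet_Ioi] with t ht
      have : (0:ℝ) < t := ht
      simp only [Pi.zero_apply]
      positivity) (by
      filter_upwards [self_mem_ae_restrict measurableSet_Ioi] with t ht
      have : (0:ℝ) < t := ht
      simp only [Pi.zero_apply]
      positivity) m1 m2
  rw [setIntegral_congr_fun measurableSet_Ioi e1, setIntegral_congr_fun measurableSet_Ioi e2,
    setIntegral_congr_fun measurableSet_Ioi e3] at hcs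
  have h1 := (line_one g hg hc).trans hcs
  have hB : 0 ≤ ∫ t in Set.Ioi (0:ℝ), (1 + t) ^ γ * |deriv g t| ^ 2 := 
    setIntegral_nonneg measurableSet_Ioi fun t ht => by
      have : (0:ℝ) < t := ht
      positivity
  calc |g 0| ^ 2 ≤ _ := pow_le_pow_left₀ (abs_nonneg _) h1 2
    _ = C0 * ∫ t in Set.Ioi (0:ℝ), (1 + t) ^ γ * |deriv g t| ^ 2 := by
      rw [mul_pow, Real.sq_sqrt hC0n, Real.sq_sqrt hB]
    _ ≤ _ := by gcongr; linarith

lemma mkPt_eq (N : ℕ) (hN : 0 < N) (y : EuclideanSpace ℝ (Fin (N - 1))) (t : ℝ) :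
    mkPt N y t = mkPt N y 0 + t • EuclideanSpace.single ⟨N - 1, Nat.sub_lt hN Nat.one_pos⟩ (1:ℝ) := by
  ext i
  by_cases h : (i:ℕ) < N - 1
  · have : i ≠ ⟨N-1, Nat.sub_lt hN Nat.one_pos⟩ := by rintro rfl; simp at h
    simp [mkPt, h, this]
  · have : i = ⟨N-1, Nat.sub_lt hN Nat.one_pos⟩ := by ext; simp; omega
    subst this
    simp [mkPt]

lemma mkPt_norm_t (N : ℕ) (hN : 0 < N) (y : EuclideanSpace ℝ (Fin (N - 1))) (t : ℝ) :
    |t| ≤ ‖mkPt N y t‖ := by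
  have := PiLp.norm_apply_le (mkPt N y t) ⟨N - 1, Nat.sub_lt hN Nat.one_pos⟩
  have h2 := mkPt_xN N hN y t
  unfold xN at h2
  rwa [h2, Real.norm_eq_abs] at this

lemma bPt_norm (N : ℕ) (hN : 0 < N) (y : EuclideanSpace ℝ (Fin (N - 1))) :
    ‖y‖ ≤ ‖bPt N y‖ := by
  obtain ⟨n, rfl⟩ : ∃ n, N = n + 1 := ⟨N - 1, by omega⟩
  rw [EuclideanSpace.norm_eq, EuclideanSpace.norm_eq]
  refine Real.sqrt_le_sqrt ?_
  rw [Fin.sum_univ_castSucc]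
  simp [bPt, mkPt]

lemma bPt_cont (N : ℕ) : Continuous (bPt N) := by
  unfold bPt mkPt
  refine (PiLp.continuous_toLp 2 _).comp (continuous_pi fun i => ?_)
  by_cases h : (i:ℕ) < N - 1
  · simp only [h, dite_true]; fun_prop
  · simp only [h, dite_false]; fun_prop

lemma line_props (N : ℕ) (hN : 0 < N) (u : EuclideanSpace ℝ (Fin N) → ℝ)
      (hu : ContDiff ℝ 1 u) (hc : HasCompactSupport u) (y : EuclideanSpace ℝ (Fin (N - 1))) :
    ContDiff ℝ 1 (fun t => u (mkPt N y t)) ∧ HasCompactSupport (fun t => u (mkPt N y t)) ∧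
    ∀ t, |deriv (fun t => u (mkPt N y t)) t| ≤ ‖fderiv ℝ u (mkPt N y t)‖ := by
  refine ⟨?_, ?_, fun t => ?_⟩
  · refine hu.comp ?_
    rw [funext (mkPt_eq N hN y)]
    fun_prop
  · obtain ⟨R, hR⟩ := hc.isCompact.isBounded.subset_closedBall 0
    refine HasCompactSupport.of_support_subset_isCompact (isCompact_closedBall 0 R) fun x hx => ?_
    have := hR (subset_tsupport u (show mkPt N y x ∈ Function.support u from hx))
    simp at this ⊢
    exact (mkPt_norm_t N hN y x).trans this
  · have h1 : HasDerivAt (fun t => mkPt N y t) (EuclideanSpace.single ⟨N - 1, Nat.sub_lt hN Nat.one_pos⟩ (1:ℝ)) t := by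
      rw [funext (mkPt_eq N hN y)]
      simpa using ((hasDerivAt_id t).smul_const (EuclideanSpace.single ⟨N - 1, Nat.sub_lt hN Nat.one_pos⟩ (1:ℝ))).const_add (mkPt N y 0)
    have h2 := (hu.differentiable one_ne_zero (mkPt N y t)).hasFDerivAt.comp_hasDerivAt t h1
    have h3 : deriv (fun t => u (mkPt N y t)) t = _ := h2.deriv
    rw [h3, ← Real.norm_eq_abs]
    refine (ContinuousLinearMap.le_opNorm _ _).trans ?_
    simp

lemma trace_int (N : ℕ) (hN : 0 < N) (u : EuclideanSpace ℝ (Fin N) → ℝ)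
      (hu : ContDiff ℝ 1 u) (hc : HasCompactSupport u) (r : ℝ) (hr : 0 < r) :
    Integrable (fun y => |u (bPt N y)| ^ r) := by
  refine Continuous.integrable_of_hasCompactSupport 
    ((hu.continuous.comp (bPt_cont N)).abs.rpow_const fun _ => Or.inr hr.le) ?_
  obtain ⟨R, hR⟩ := hc.isCompact.isBounded.subset_closedBall 0
  refine HasCompactSupport.of_support_subset_isCompact (isCompact_closedBall 0 R) fun x hx => ?_
  have hx' : u (bPt N x) ≠ 0 := by
    intro h
    simp [h, Real.zero_rpow hr.ne'] at hx
  have := hR (subset_tsupport u (show bPt N x ∈ Function.support u from hx'))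
  simp at this ⊢
  exact (bPt_norm N hN x).trans this

lemma trace_two (N : ℕ) (hN : 0 < N) (γ : ℝ) (hγ : 1 < γ) : 
    ∃ C > (0 : ℝ), ∀ u : EuclideanSpace ℝ (Fin N) → ℝ,
      ContDiff ℝ 1 u → HasCompactSupport u →
      (∫ y : EuclideanSpace ℝ (Fin (N - 1)), |u (bPt N y)| ^ (2:ℝ)) ≤
        C * ∫ x in Hplus N hN, (1 + xN N hN x) ^ γ * ‖fderiv ℝ u x‖ ^ 2 := by
  obtain ⟨C, hC, h⟩ := line_two γ hγ
  refine ⟨C, hC, fun u hu hc => ?_⟩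
  have hcF : Continuous (fun x => (1 + xN N hN x) ^ γ * ‖fderiv ℝ u x‖ ^ 2) := by
    refine Continuous.mul (Continuous.rpow_const (by unfold xN; fun_prop) fun x => Or.inr (by linarith)) ?_
    exact (hu.continuous_fderiv one_ne_zero).norm.pow 2
  have hsF : HasCompactSupport (fun x => (1 + xN N hN x) ^ γ * ‖fderiv ℝ u x‖ ^ 2) :=
    HasCompactSupport.mul_left ((hc.fderiv ℝ).comp_left (g := fun t => ‖t‖ ^ 2) (by simp))
  obtain ⟨i1, i2⟩ := int_H_aux N hN _ (hcF.integrable_of_hasCompactSupport hsF)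
  rw [i2, ← integral_const_mul]
  refine integral_mono (trace_int N hN u hu hc 2 (by norm_num)) (i1.const_mul C) fun y => ?_
  obtain ⟨p1, p2, p3⟩ := line_props N hN u hu hc y
  have h1 := h _ p1 p2
  simp only [mkPt_xN, Real.rpow_two]
  refine h1.trans ?_
  refine mul_le_mul_of_nonneg_left ?_ hC.le
  have hcm : Continuous (fun t => mkPt N y t) := by
    rw [funext (mkPt_eq N hN y)]
    fun_prop
  refine integral_mono_of_nonneg ?_ ?_ ?_
  · filter_upwards [self_mem_ae_restrict measurableSet_Ioi] with t ht
    have : (0:ℝ) < t := ht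
    simp only [Pi.zero_apply]
    positivity
  · have h5 : Continuous (fun t => (1 + t) ^ γ * ‖fderiv ℝ u (mkPt N y t)‖ ^ 2) := by
      have := hcF.comp hcm
      simpa [Function.comp_def, mkPt_xN] using this
    refine (h5.integrable_of_hasCompactSupport ?_).integrableOn
    refine HasCompactSupport.mul_left ?_
    obtain ⟨R, hR⟩ := hc.isCompact.isBounded.subset_closedBall 0
    refine HasCompactSupport.of_support_subset_isCompact (isCompact_closedBall 0 R) fun x hx => ?_
    have hx' : fderiv ℝ u (mkPt N y x) ≠ 0 := by
      intro h
      simp [h] at hx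
    have := hR ((tsupport_fderiv_subset ℝ) (subset_tsupport _ (show mkPt N y x ∈ Function.support (fderiv ℝ u) from hx')))
    simp at this ⊢
    exact (mkPt_norm_t N hN y x).trans this
  · filter_upwards [self_mem_ae_restrict measurableSet_Ioi] with t ht
    have : (0:ℝ) < t := ht
    have := p3 t
    gcongr

lemma trace_s (N : ℕ) (hN : 3 ≤ N) (hN0 : 0 < N) : 
    ∃ C > (0 : ℝ), ∀ u : EuclideanSpace ℝ (Fin N) → ℝ,
      ContDiff ℝ 1 u → HasCompactSupport u →
      (∫ y : EuclideanSpace ℝ (Fin (N - 1)), |u (bPt N y)| ^ (2 * ((N : ℝ) - 1) / ((N : ℝ) - 2))) ≤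
        C * (∫ x in Hplus N hN0, ‖fderiv ℝ u x‖ ^ 2) ^ (((N : ℝ) - 1) / ((N : ℝ) - 2)) := by
  have hN' : (3:ℝ) ≤ N := by exact_mod_cast hN
  have hN2 : (0:ℝ) < N - 2 := by linarith
  obtain ⟨K, hK, h⟩ := half_sobolev N hN hN0
  set s := 2 * ((N : ℝ) - 1) / ((N : ℝ) - 2) with hs
  have hs2 : 2 ≤ s := by rw [hs, le_div_iff₀ hN2]; linarith
  refine ⟨s * √K, by positivity, fun u hu hc => ?_⟩
  have hcf := hu.continuous_fderiv one_ne_zero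
  have hsf := hc.fderiv ℝ
  have hcu : Continuous (fun x => |u x| ^ (s - 1)) := hu.continuous.abs.rpow_const fun _ => Or.inr (by linarith)
  have hsu : HasCompactSupport (fun x => |u x| ^ (s - 1)) :=
    (hc.comp_left (g := fun t => |t| ^ (s - 1)) (by simp; rw [Real.zero_rpow]; linarith))
  have hcF : Continuous (fun x => s * (|u x| ^ (s - 1) * ‖fderiv ℝ u x‖)) :=
    continuous_const.mul (hcu.mul hcf.norm)
  have hsF : HasCompactSupport (fun x => s * (|u x| ^ (s - 1) * ‖fderiv ℝ u x‖)) :=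
    HasCompactSupport.mul_left (hsu.mul_right)
  obtain ⟨i1, i2⟩ := int_H_aux N hN0 _ (hcF.integrable_of_hasCompactSupport hsF)
  have step1 : (∫ y : EuclideanSpace ℝ (Fin (N - 1)), |u (bPt N y)| ^ s) ≤ 
      ∫ x in Hplus N hN0, s * (|u x| ^ (s - 1) * ‖fderiv ℝ u x‖) := by
    rw [i2]
    refine integral_mono (trace_int N hN0 u hu hc s (by linarith)) i1 fun y => ?_
    obtain ⟨p1, p2, p3⟩ := line_props N hN0 u hu hc y
    refine (line_s _ p1 p2 s hs2).trans ?_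
    have hcm : Continuous (fun t => mkPt N y t) := by
      rw [funext (mkPt_eq N hN0 y)]
      fun_prop
    refine integral_mono_of_nonneg (Eventually.of_forall fun t => ?_) ?_ (Eventually.of_forall fun t => ?_)
    · simp only [Pi.zero_apply]; positivity
    · refine ((hcF.comp hcm).integrable_of_hasCompactSupport ?_).integrableOn
      exact HasCompactSupport.mul_left (HasCompactSupport.mul_right (p2.comp_left (g := fun t => |t| ^ (s - 1)) (by simp; rw [Real.zero_rpow]; linarith)))
    · have := p3 t
      simp only
      gcongr
  rw [integral_const_mul] at step1
  have hcs := cs_aux (volume.restrict (Hplus N hN0)) (fun x => |u x| ^ (s - 1)) (fun x => ‖fderiv ℝ u x‖)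
    (Eventually.of_forall fun x => by simp only [Pi.zero_apply]; positivity)
    (Eventually.of_forall fun x => by simp only [Pi.zero_apply]; positivity)
    ((hcu.memLp_of_hasCompactSupport hsu).restrict _)
    ((hcf.norm.memLp_of_hasCompactSupport hsf.norm).restrict _)
  have e1 : ∀ x, (|u x| ^ (s - 1)) ^ 2 = |u x| ^ (2 * (N:ℝ) / (N - 2)) := fun x => by
    rw [← Real.rpow_mul_natCast (abs_nonneg _)]
    congr 1
    rw [hs]; push_cast; field_simp; ring
  simp_rw [e1] at hcs
  have hS := h u hu hc
  set D := ∫ x in Hplus N hN0, ‖fderiv ℝ u x‖ ^ 2 with hD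
  have hD0 : 0 ≤ D := by positivity
  calc _ ≤ _ := step1
    _ ≤ s * (√(K * D ^ ((N:ℝ) / (N - 2))) * √D) := by
      gcongr
      refine hcs.trans ?_
      gcongr
    _ = _ := by
      rw [Real.sqrt_mul hK.le, Real.sqrt_eq_rpow (D ^ _), Real.sqrt_eq_rpow D, ← Real.rpow_mul hD0, mul_assoc, mul_assoc, ← Real.rpow_add_of_nonneg hD0 (by positivity) (by positivity)]
      congr 3
      field_simp; ring

end aux

theorem stmt1 (N : ℕ) (hN : 3 ≤ N) (γ q : ℝ) (hγ : 1 < γ) (hq1 : 2 ≤ q)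
    (hq2 : q ≤ 2 * ((N : ℝ) - 1) / ((N : ℝ) - 2)) :
    ∃ C > (0 : ℝ), ∀ u : EuclideanSpace ℝ (Fin N) → ℝ,
      ContDiff ℝ (⊤ : ℕ∞) u → HasCompactSupport u →
      (∫ y : EuclideanSpace ℝ (Fin (N - 1)), |u (bPt N y)| ^ q) ^ (2 / q) ≤
        C * ∫ x in Hplus N (by omega),
          (1 + xN N (by omega) x) ^ γ * ‖gradient u x‖ ^ 2 := by
  have hN' : (3:ℝ) ≤ N := by exact_mod_cast hN
  have hN0 : 0 < N := by omega
  have hN2 : (0:ℝ) < N - 2 := by linarith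
  obtain ⟨C1, hC1, h1⟩ := trace_two N hN0 γ hγ
  obtain ⟨C2, hC2, h2⟩ := trace_s N hN hN0
  set s := 2 * ((N : ℝ) - 1) / ((N : ℝ) - 2) with hs
  have hs2 : s / 2 = ((N : ℝ) - 1) / ((N : ℝ) - 2) := by rw [hs]; field_simp
  rw [← hs2] at h2
  refine ⟨(C1 + C2) ^ (2 / q), by positivity, fun u hu' hc => ?_⟩
  have hu : ContDiff ℝ 1 u := hu'.of_le (by exact_mod_cast le_top)
  have hgr : ∀ x, ‖gradient u x‖ = ‖fderiv ℝ u x‖ := fun x => by simp [gradient]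
  simp_rw [hgr]
  have T1 := h1 u hu hc
  have T2 := h2 u hu hc
  set A := ∫ x in Hplus N hN0, (1 + xN N hN0 x) ^ γ * ‖fderiv ℝ u x‖ ^ 2 with hA
  have hcF : Continuous (fun x => (1 + xN N hN0 x) ^ γ * ‖fderiv ℝ u x‖ ^ 2) := by
    refine Continuous.mul (Continuous.rpow_const (by unfold xN; fun_prop) fun x => Or.inr (by linarith)) ?_
    exact (hu.continuous_fderiv one_ne_zero).norm.pow 2
  have hsF : HasCompactSupport (fun x => (1 + xN N hN0 x) ^ γ * ‖fderiv ℝ u x‖ ^ 2) :=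
    HasCompactSupport.mul_left ((hc.fderiv ℝ).comp_left (g := fun t => ‖t‖ ^ 2) (by simp))
  have hD0 : 0 ≤ ∫ x in Hplus N hN0, ‖fderiv ℝ u x‖ ^ 2 := by positivity
  have hDA : ∫ x in Hplus N hN0, ‖fderiv ℝ u x‖ ^ 2 ≤ A := by
    refine integral_mono_of_nonneg (Eventually.of_forall fun x => by simp only [Pi.zero_apply]; positivity)
      (hcF.integrable_of_hasCompactSupport hsF).integrableOn ?_
    filter_upwards [self_mem_ae_restrict (Hplus_meas N hN0)] with x hx
    have hx : 0 < xN N hN0 x := hx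
    exact le_mul_of_one_le_left (by positivity) (Real.one_le_rpow (by linarith) (by linarith))
  have hA0 : 0 ≤ A := hD0.trans hDA
  have hs0 : 2 ≤ s := hq1.trans hq2
  have T2' : (∫ y : EuclideanSpace ℝ (Fin (N - 1)), |u (bPt N y)| ^ s) ≤ C2 * A ^ (s / 2) :=
    T2.trans (by gcongr)
  have key : (∫ y : EuclideanSpace ℝ (Fin (N - 1)), |u (bPt N y)| ^ q) ≤ (C1 + C2) * A ^ (q / 2) := by
    rcases hA0.eq_or_lt with h0 | hpos
    · rw [← h0, mul_zero] at T1
      have i2 := trace_int N hN0 u hu hc 2 (by norm_num)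
      have T0 : ∫ y : EuclideanSpace ℝ (Fin (N - 1)), |u (bPt N y)| ^ (2:ℝ) = 0 :=
        le_antisymm T1 (by positivity)
      rw [integral_eq_zero_iff_of_nonneg (fun y => by simp only [Pi.zero_apply]; positivity) i2] at T0
      have : ∫ y : EuclideanSpace ℝ (Fin (N - 1)), |u (bPt N y)| ^ q = 0 := by
        refine integral_eq_zero_of_ae ?_
        filter_upwards [T0] with y hy
        simp at hy
        simp [hy]
        rw [Real.zero_rpow]; linarith
      rw [this]; positivity
    · set l := √A with hl
      have hl0 : 0 < l := by positivity
      have hlp : ∀ r : ℝ, A ^ (r / 2) = l ^ r := fun r => by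
        rw [hl, Real.sqrt_eq_rpow, ← Real.rpow_mul hA0]; congr 1; ring
      have hA1 : A = l ^ (2:ℝ) := by rw [← hlp]; simp
      rw [hlp] at T2' ⊢
      rw [hA1] at T1
      have i1 := trace_int N hN0 u hu hc 2 (by norm_num)
      have i2 := trace_int N hN0 u hu hc s (by linarith)
      calc _ ≤ ∫ y : EuclideanSpace ℝ (Fin (N - 1)), 
            (l ^ (q - 2) * |u (bPt N y)| ^ (2:ℝ) + l ^ (q - s) * |u (bPt N y)| ^ s) := by
            refine integral_mono (trace_int N hN0 u hu hc q (by linarith)) ((i1.const_mul _).add (i2.const_mul _)) fun y => ?_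
            simp only
            set a := |u (bPt N y)| with ha
            have ha0 : 0 ≤ a := abs_nonneg _
            rcases ha0.eq_or_lt with h | hap
            · rw [← h, Real.zero_rpow (by linarith)]; positivity
            rcases le_total a l with hal | hal
            · have : a ^ q ≤ l ^ (q - 2) * a ^ (2:ℝ) := by
                rw [show a ^ q = a ^ (q - 2) * a ^ (2:ℝ) by rw [← Real.rpow_add hap]; congr 1; ring]
                have := Real.rpow_le_rpow ha0 hal (show 0 ≤ q - 2 by linarith)
                gcongr
              have : 0 ≤ l ^ (q - s) * a ^ s := by positivity
              linarith
            · have : a ^ q ≤ l ^ (q - s) * a ^ s := by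
                rw [show a ^ q = a ^ (q - s) * a ^ s by rw [← Real.rpow_add hap]; congr 1; ring]
                have := Real.rpow_le_rpow_of_nonpos hl0 hal (show q - s ≤ 0 by linarith)
                gcongr
              have : 0 ≤ l ^ (q - 2) * a ^ (2:ℝ) := by positivity
              linarith
        _ = l ^ (q - 2) * (∫ y : EuclideanSpace ℝ (Fin (N - 1)), |u (bPt N y)| ^ (2:ℝ)) + 
            l ^ (q - s) * (∫ y : EuclideanSpace ℝ (Fin (N - 1)), |u (bPt N y)| ^ s) := by
            rw [integral_add (i1.const_mul _) (i2.const_mul _), integral_const_mul, integral_const_mul]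
        _ ≤ l ^ (q - 2) * (C1 * l ^ (2:ℝ)) + l ^ (q - s) * (C2 * l ^ s) := by gcongr
        _ = C1 * (l ^ (q - 2) * l ^ (2:ℝ)) + C2 * (l ^ (q - s) * l ^ s) := by ring
        _ = _ := by
            rw [← Real.rpow_add hl0, ← Real.rpow_add hl0]
            simp only [sub_add_cancel]; ring
  have hq0 : 0 < q := by linarith
  calc _ ≤ ((C1 + C2) * A ^ (q / 2)) ^ (2 / q) := by
        refine Real.rpow_le_rpow (by positivity) key (by positivity)
    _ = _ := by
        rw [Real.mul_rpow (by positivity) (by positivity), ← Real.rpow_mul hA0]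
        rw [show q / 2 * (2 / q) = 1 by field_simp, Real.rpow_one]
end
end

section
/- Let $N\ge3$ and $\gamma\ge2$. There exists a constant $C>0$, depending only on $N$ and $\gamma$, with the following property: if $u\in C_c^\infty(\mathbb{R}^N)$ is nonnegative, cylindrically symmetric in $x'$ (i.e. $u(x',x_N)$ depends only on $(|x'|,x_N)$), and $|x'|\mapsto u(x',x_N)$ is nonincreasing for each fixed $x_N\ge0$, then for every $(x',x_N)\in\mathbb{R}^N_+$ with $x'\ne0$, $u(x',x_N)\le C\,|x'|^{-(N-1)/2}\left(\int_{\mathbb{R}^N_+}(1+y_N)^{\gamma}|\nabla u(y)|^2\,dy\right)^{1/2}$. -/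
open MeasureTheory Filter
open scoped Topology ENNReal

noncomputable section

/-- One-dimensional weighted estimate. -/
theorem oneD (g g' w : ℝ → ℝ) (hg : ∀ s, HasDerivAt g (g' s) s) (hg' : Continuous g')
    (hw : IntegrableOn w (Set.Ioi 0)) (hwg : ∀ s, 0 < s → (1 + s) ^ 2 * g' s ^ 2 ≤ w s)
    (t T : ℝ) (ht : 0 < t) (htT : t ≤ T) (hT : g T = 0) :
    g t ^ 2 ≤ ∫ s in Set.Ioi (0 : ℝ), w s := by
  set c := g t with hc
  have hwI : IntervalIntegrable w volume t T := by
    rw [intervalIntegrable_iff_integrableOn_Ioc_of_le htT]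
    exact hw.mono_set fun s hs => lt_trans ht hs.1
  have hle : ∫ s in t..T, w s ≤ ∫ s in Set.Ioi (0 : ℝ), w s := by
    rw [intervalIntegral.integral_of_le htT]
    apply setIntegral_mono_set hw
    · filter_upwards [ae_restrict_mem measurableSet_Ioi] with s hs
      exact le_trans (by positivity) (hwg s hs)
    · exact Eventually.of_forall fun s hs => lt_trans ht hs.1
  have hpos : ∀ s ∈ Set.uIcc t T, 0 < 1 + s := by
    intro s hs
    rw [Set.uIcc_of_le htT] at hs
    linarith [hs.1]
  have hcont : ContinuousOn (fun s : ℝ => ((1 + s) ^ 2)⁻¹) (Set.uIcc t T) := by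
    apply ContinuousOn.inv₀ (by fun_prop)
    intro s hs
    have := hpos s hs
    positivity
  have h1 : ∫ s in t..T, g' s = -c := by
    rw [intervalIntegral.integral_eq_sub_of_hasDerivAt (fun s _ => hg s)
      (hg'.intervalIntegrable _ _), hT]
    ring
  have h2 : ∫ s in t..T, ((1 + s) ^ 2)⁻¹ = -(1 + T)⁻¹ - -(1 + t)⁻¹ := by
    refine intervalIntegral.integral_eq_sub_of_hasDerivAt (f := fun s => -(1 + s)⁻¹) ?_
      hcont.intervalIntegrable
    intro s hs
    have h0 := (((hasDerivAt_id s).const_add 1).inv (hpos s hs).ne').neg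
    have h00 : -(-1 / (1 + id s) ^ 2) = ((1 + s) ^ 2)⁻¹ := by
      simp only [id]
      ring
    rw [h00] at h0
    exact h0
  have h3 : ∫ s in t..T, (-(2 * c) * g' s) ≤ ∫ s in t..T, (w s + c ^ 2 * ((1 + s) ^ 2)⁻¹) := by
    apply intervalIntegral.integral_mono_on htT
    · exact (hg'.intervalIntegrable _ _).const_mul _
    · exact hwI.add (hcont.intervalIntegrable.const_mul _)
    · intro s hs
      have h0 : 0 < 1 + s := by linarith [hs.1]
      have := hwg s (by linarith [hs.1])
      have h5 : 0 ≤ ((1 + s) * g' s + c * (1 + s)⁻¹) ^ 2 := sq_nonneg _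
      have h6 : ((1 + s) * g' s + c * (1 + s)⁻¹) ^ 2
          = (1 + s) ^ 2 * g' s ^ 2 + 2 * c * g' s + c ^ 2 * ((1 + s) ^ 2)⁻¹ := by
        field_simp
        ring
      linarith
  rw [intervalIntegral.integral_const_mul, h1, intervalIntegral.integral_add hwI
    (hcont.intervalIntegrable.const_mul _), intervalIntegral.integral_const_mul, h2] at h3
  have h7 : (1 + t)⁻¹ ≤ 1 := inv_le_one_of_one_le₀ (by linarith)
  have h8 : 0 ≤ (1 + T)⁻¹ := inv_nonneg.2 (by linarith)
  have h9 : c ^ 2 * (-(1 + T)⁻¹ - -(1 + t)⁻¹) ≤ c ^ 2 * 1 :=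
    mul_le_mul_of_nonneg_left (by linarith) (sq_nonneg c)
  linarith

/-- `mkPt` as a measurable equivalence. -/
def PhiE (n : ℕ) : EuclideanSpace ℝ (Fin n) × ℝ ≃ᵐ EuclideanSpace ℝ (Fin (n + 1)) :=
  ((MeasurableEquiv.prodComm.trans
    ((MeasurableEquiv.refl ℝ).prodCongr (MeasurableEquiv.toLp 2 (Fin n → ℝ)).symm)).trans
    (MeasurableEquiv.piFinSuccAbove (fun _ : Fin (n + 1) => ℝ) (Fin.last n)).symm).trans
    (MeasurableEquiv.toLp 2 (Fin (n + 1) → ℝ))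

theorem PhiE_apply (n : ℕ) (p : EuclideanSpace ℝ (Fin n) × ℝ) :
    PhiE n p = mkPt (n + 1) p.1 p.2 := by
  ext i
  refine Fin.lastCases ?_ (fun j => ?_) i
  · simp [PhiE, mkPt]
    rfl
  · simp [PhiE, mkPt]
    rfl

theorem PhiE_mp (n : ℕ) : MeasurePreserving (PhiE n) volume volume := by
  have h1 : MeasurePreserving
      (MeasurableEquiv.prodComm : EuclideanSpace ℝ (Fin n) × ℝ ≃ᵐ ℝ × EuclideanSpace ℝ (Fin n))
      volume volume := Measure.measurePreserving_swap
  have h2 : MeasurePreserving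
      ((MeasurableEquiv.refl ℝ).prodCongr (MeasurableEquiv.toLp 2 (Fin n → ℝ)).symm)
      (volume : Measure (ℝ × EuclideanSpace ℝ (Fin n))) volume :=
    (MeasurePreserving.id volume).prod (PiLp.volume_preserving_ofLp (Fin n))
  have h3 := (volume_preserving_piFinSuccAbove (fun _ : Fin (n + 1) => ℝ) (Fin.last n)).symm
  exact (PiLp.volume_preserving_toLp (Fin (n + 1))).comp (h3.comp (h2.comp h1))

theorem mkPt_eq_s7 (n : ℕ) (y : EuclideanSpace ℝ (Fin n)) (s : ℝ) :
    mkPt (n + 1) y s = mkPt (n + 1) y 0 + s • EuclideanSpace.single (Fin.last n) (1 : ℝ) := by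
  ext i
  refine Fin.lastCases ?_ (fun j => ?_) i
  · simp [mkPt]
  · simp [mkPt, Fin.castSucc_ne_last]

theorem mkPt_last (n : ℕ) (y : EuclideanSpace ℝ (Fin n)) (s : ℝ) :
    (mkPt (n + 1) y s) (Fin.last n) = s := by
  simp [mkPt]

theorem key (n : ℕ) (γ : ℝ) (hγ : 2 ≤ γ) (u : EuclideanSpace ℝ (Fin (n + 1)) → ℝ)
    (hu : ContDiff ℝ (⊤ : ℕ∞) u) (hcs : HasCompactSupport u)
    (hpos : ∀ (y : EuclideanSpace ℝ (Fin n)) (t : ℝ), 0 ≤ u (mkPt (n + 1) y t))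
    (hmono : ∀ (y₁ y₂ : EuclideanSpace ℝ (Fin n)) (t : ℝ), 0 ≤ t →
        ‖y₁‖ ≤ ‖y₂‖ → u (mkPt (n + 1) y₂ t) ≤ u (mkPt (n + 1) y₁ t))
    (y : EuclideanSpace ℝ (Fin n)) (t : ℝ) (ht : 0 < t) :
    volume.real (Metric.ball (0 : EuclideanSpace ℝ (Fin n)) ‖y‖) * u (mkPt (n + 1) y t) ^ 2 ≤
      ∫ x in {x : EuclideanSpace ℝ (Fin (n + 1)) | 0 < x (Fin.last n)},
            (1 + x (Fin.last n)) ^ γ * ‖gradient u x‖ ^ 2 := by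
  set F : EuclideanSpace ℝ (Fin (n + 1)) → ℝ :=
    fun x => (1 + x (Fin.last n)) ^ γ * ‖gradient u x‖ ^ 2 with hF
  have hgn : ∀ x, ‖gradient u x‖ = ‖fderiv ℝ u x‖ := fun x => by simp [gradient]
  have hfc : Continuous (fderiv ℝ u) := hu.continuous_fderiv (by simp)
  have hFc : Continuous F := by
    have : Continuous fun x : EuclideanSpace ℝ (Fin (n + 1)) => (1 + x (Fin.last n)) ^ γ :=
      (Real.continuous_rpow_const (by linarith)).comp (by fun_prop)
    simp only [hF, hgn]
    exact this.mul (hfc.norm.pow 2)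
  have hFcs : HasCompactSupport F := by
    refine (hcs.fderiv (𝕜 := ℝ)).mono ?_
    intro x hx
    contrapose! hx
    have : fderiv ℝ u x = 0 := by simpa using hx
    simp [hF, hgn, this]
  have hFi : Integrable F := hFc.integrable_of_hasCompactSupport hFcs
  set S := {x : EuclideanSpace ℝ (Fin (n + 1)) | 0 < x (Fin.last n)}
  have hFnn : ∀ x ∈ S, 0 ≤ F x := fun x hx => by
    have hx' : 0 < x (Fin.last n) := hx
    have : 0 ≤ 1 + x (Fin.last n) := by linarith
    simp only [hF]; positivity
  have hGi : Integrable (fun p => F (PhiE n p)) (volume.prod volume) :=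
    ((PhiE_mp n).integrable_comp_emb (PhiE n).measurableEmbedding).2 hFi
  have hpre : PhiE n ⁻¹' S = Set.univ ×ˢ Set.Ioi 0 := by
    ext p
    simp only [Set.mem_preimage, PhiE_apply, S, Set.mem_ofPred_eq, mkPt_last]
    simp
  have e1 : ∫ x in S, F x = ∫ p in Set.univ ×ˢ Set.Ioi (0 : ℝ), F (PhiE n p) := by
    rw [← hpre, (PhiE_mp n).setIntegral_preimage_emb (PhiE n).measurableEmbedding]
  set B := Metric.ball (0 : EuclideanSpace ℝ (Fin n)) ‖y‖
  have e2 : ∫ p in B ×ˢ Set.Ioi (0 : ℝ), F (PhiE n p) ≤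
      ∫ p in Set.univ ×ˢ Set.Ioi (0 : ℝ), F (PhiE n p) := by
    apply setIntegral_mono_set hGi.integrableOn
    · filter_upwards [ae_restrict_mem (MeasurableSet.univ.prod measurableSet_Ioi)] with p hp
      apply hFnn
      rw [← hpre] at hp
      exact hp
    · exact Eventually.of_forall fun p hp => ⟨trivial, hp.2⟩
  have hGB : IntegrableOn (fun p => F (PhiE n p)) (B ×ˢ Set.Ioi (0 : ℝ)) (volume.prod volume) :=
    hGi.integrableOn
  have e3 : ∫ p in B ×ˢ Set.Ioi (0 : ℝ), F (PhiE n p) =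
      ∫ z in B, ∫ s in Set.Ioi (0 : ℝ), F (PhiE n (z, s)) :=
    setIntegral_prod _ hGB
  have hline : ∀ z : EuclideanSpace ℝ (Fin n), Continuous fun s : ℝ => mkPt (n + 1) z s := by
    intro z
    have : (fun s : ℝ => mkPt (n + 1) z s) = fun s => mkPt (n + 1) z 0 +
      s • EuclideanSpace.single (Fin.last n) (1 : ℝ) := funext fun s => mkPt_eq_s7 n z s
    rw [this]; fun_prop
  obtain ⟨R, hR⟩ := hcs.isCompact.isBounded.subset_closedBall 0
  have hzero : ∀ x, R < ‖x‖ → u x = 0 := by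
    intro x hx
    by_contra h
    have := hR (subset_tsupport u h)
    simp at this
    linarith
  have hnormT : ∀ (z : EuclideanSpace ℝ (Fin n)) (s : ℝ), |s| ≤ ‖mkPt (n + 1) z s‖ := by
    intro z s
    have := PiLp.norm_apply_le (mkPt (n + 1) z s) (Fin.last n)
    rwa [mkPt_last] at this
  have hFline : ∀ z s, F (mkPt (n + 1) z s) = (1 + s) ^ γ * ‖fderiv ℝ u (mkPt (n + 1) z s)‖ ^ 2 := by
    intro z s
    simp only [hF, mkPt_last, hgn]
  have hslice : ∀ z ∈ B, u (mkPt (n + 1) y t) ^ 2 ≤ ∫ s in Set.Ioi (0 : ℝ), F (PhiE n (z, s)) := by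
    intro z hz
    have hz' : ‖z‖ ≤ ‖y‖ := by
      have : ‖z‖ < ‖y‖ := by simpa [B] using hz
      exact this.le
    refine (pow_le_pow_left₀ (hpos y t) (hmono z y t ht.le hz') 2).trans ?_
    have hcz : Continuous fun s => F (mkPt (n + 1) z s) := hFc.comp (hline z)
    have hcsz : HasCompactSupport fun s => F (mkPt (n + 1) z s) := by
      refine HasCompactSupport.of_support_subset_isCompact (isCompact_closedBall (0 : ℝ) R) ?_
      intro s hs
      simp only [mem_closedBall_zero_iff, Real.norm_eq_abs]
      by_contra hlt
      push Not at hlt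
      apply hs
      have h0 : fderiv ℝ u (mkPt (n + 1) z s) = 0 := by
        by_contra hne
        have := hR (support_fderiv_subset ℝ hne)
        rw [mem_closedBall_zero_iff] at this
        linarith [hnormT z s]
      simp [hFline, h0]
    refine oneD (fun s => u (mkPt (n + 1) z s))
      (fun s => fderiv ℝ u (mkPt (n + 1) z s) (EuclideanSpace.single (Fin.last n) (1 : ℝ)))
      _ ?_ ?_ ?_ ?_ t (max t (|R| + 1)) ht (le_max_left _ _) ?_
    · intro s
      have h1 : HasDerivAt (fun s : ℝ => mkPt (n + 1) z s)
          (EuclideanSpace.single (Fin.last n) (1 : ℝ)) s := by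
        have : (fun s : ℝ => mkPt (n + 1) z s) = fun s => mkPt (n + 1) z 0 +
          s • EuclideanSpace.single (Fin.last n) (1 : ℝ) := funext fun s => mkPt_eq_s7 n z s
        rw [this]
        simpa using ((hasDerivAt_id s).smul_const
          (EuclideanSpace.single (Fin.last n) (1 : ℝ))).const_add (mkPt (n + 1) z 0)
      exact ((hu.differentiable (by simp)) _).hasFDerivAt.comp_hasDerivAt s h1
    · exact (hfc.comp (hline z)).clm_apply continuous_const
    · simp only [PhiE_apply]
      exact (hcz.integrable_of_hasCompactSupport hcsz).integrableOn
    · intro s hs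
      simp only [PhiE_apply, hFline]
      have hA : (1 + s) ^ 2 ≤ (1 + s) ^ γ := by
        rw [← Real.rpow_natCast]
        exact Real.rpow_le_rpow_of_exponent_le (by linarith) (by simpa using hγ)
      have hB : |fderiv ℝ u (mkPt (n + 1) z s) (EuclideanSpace.single (Fin.last n) (1 : ℝ))|
          ≤ ‖fderiv ℝ u (mkPt (n + 1) z s)‖ := by
        have := (fderiv ℝ u (mkPt (n + 1) z s)).le_opNorm
          (EuclideanSpace.single (Fin.last n) (1 : ℝ))
        simpa using this
      rw [← sq_abs (fderiv ℝ u (mkPt (n + 1) z s) _)]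
      gcongr
    · apply hzero
      have h1 := hnormT z (max t (|R| + 1))
      have h2 := le_abs_self (max t (|R| + 1))
      have h3 := le_max_right t (|R| + 1)
      linarith [le_abs_self R]
  rw [e1]
  refine le_trans ?_ e2
  rw [e3]
  have e4 : ∫ z in B, u (mkPt (n + 1) y t) ^ 2 ≤
      ∫ z in B, ∫ s in Set.Ioi (0 : ℝ), F (PhiE n (z, s)) := by
    refine setIntegral_mono_on ?_ ?_ Metric.isOpen_ball.measurableSet hslice
    · exact integrableOn_const (measure_ball_lt_top.ne)
    · have := hGB
      rw [IntegrableOn, ← Measure.prod_restrict] at this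
      exact this.integral_prod_left
  simpa using e4

theorem stmt7 (N : ℕ) (hN : 3 ≤ N) (γ : ℝ) (hγ : 2 ≤ γ) :
    ∃ C > (0 : ℝ), ∀ u : EuclideanSpace ℝ (Fin N) → ℝ,
      ContDiff ℝ (⊤ : ℕ∞) u → HasCompactSupport u →
      (∀ (y : EuclideanSpace ℝ (Fin (N - 1))) (t : ℝ), 0 ≤ u (mkPt N y t)) →
      (∀ (y₁ y₂ : EuclideanSpace ℝ (Fin (N - 1))) (t : ℝ),
        ‖y₁‖ = ‖y₂‖ → u (mkPt N y₁ t) = u (mkPt N y₂ t)) →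
      (∀ (y₁ y₂ : EuclideanSpace ℝ (Fin (N - 1))) (t : ℝ), 0 ≤ t →
        ‖y₁‖ ≤ ‖y₂‖ → u (mkPt N y₂ t) ≤ u (mkPt N y₁ t)) →
      ∀ y : EuclideanSpace ℝ (Fin (N - 1)), y ≠ 0 → ∀ t : ℝ, 0 < t →
        u (mkPt N y t) ≤ C * ‖y‖ ^ (-(((N : ℝ) - 1) / 2)) *
          (∫ x in Hplus N (by omega),
            (1 + xN N (by omega) x) ^ γ * ‖gradient u x‖ ^ 2) ^ (1 / 2 : ℝ) := by
  obtain ⟨n, rfl⟩ : ∃ n, N = n + 1 := ⟨N - 1, by omega⟩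
  set b := volume.real (Metric.ball (0 : EuclideanSpace ℝ (Fin n)) 1) with hb
  have hb0 : 0 < b :=
    ENNReal.toReal_pos (Metric.measure_ball_pos volume _ one_pos).ne' measure_ball_lt_top.ne
  refine ⟨b ^ (-(1 / 2) : ℝ), Real.rpow_pos_of_pos hb0 _, ?_⟩
  intro u hu hcs hpos _ hmono y hy t ht
  have hy0 : 0 < ‖y‖ := norm_pos_iff.2 hy
  have hk := key n γ hγ u hu hcs hpos hmono y t ht
  change _ ≤ b ^ (-(1 / 2) : ℝ) * ‖y‖ ^ (-((((n + 1 : ℕ) : ℝ) - 1) / 2)) *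
    (∫ x in {x : EuclideanSpace ℝ (Fin (n + 1)) | 0 < x (Fin.last n)},
            (1 + x (Fin.last n)) ^ γ * ‖gradient u x‖ ^ 2) ^ (1 / 2 : ℝ)
  set I := ∫ x in {x : EuclideanSpace ℝ (Fin (n + 1)) | 0 < x (Fin.last n)},
            (1 + x (Fin.last n)) ^ γ * ‖gradient u x‖ ^ 2
  have hvol : volume.real (Metric.ball (0 : EuclideanSpace ℝ (Fin n)) ‖y‖) = ‖y‖ ^ n * b := by
    rw [hb, Measure.real, Measure.addHaar_ball_of_pos volume _ hy0]
    simp [Measure.real, ENNReal.toReal_mul]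
  rw [hvol] at hk
  have hu0 := hpos y t
  change 0 ≤ u (mkPt (n + 1) y t) at hu0
  set c := u (mkPt (n + 1) y t)
  have h2 : (‖y‖ ^ n * b * c ^ 2) ^ (1 / 2 : ℝ) ≤ I ^ (1 / 2 : ℝ) :=
    Real.rpow_le_rpow (by positivity) hk (by norm_num)
  have h3 : (‖y‖ ^ n * b * c ^ 2) ^ (1 / 2 : ℝ) = ‖y‖ ^ ((n : ℝ) / 2) * b ^ (1 / 2 : ℝ) * c := by
    rw [Real.mul_rpow (by positivity) (by positivity), Real.mul_rpow (by positivity) hb0.le,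
      ← Real.sqrt_eq_rpow (c ^ 2), Real.sqrt_sq hu0, ← Real.rpow_natCast, ← Real.rpow_mul hy0.le]
    congr 3
    ring
  rw [h3] at h2
  have e1 : -((((n + 1 : ℕ) : ℝ) - 1) / 2) = -((n : ℝ) / 2) := by push_cast; ring
  rw [e1, Real.rpow_neg hb0.le, Real.rpow_neg hy0.le]
  have p1 : 0 < ‖y‖ ^ ((n : ℝ) / 2) := Real.rpow_pos_of_pos hy0 _
  have p2 : 0 < b ^ (1 / 2 : ℝ) := Real.rpow_pos_of_pos hb0 _
  calc c = (b ^ (1 / 2 : ℝ))⁻¹ * (‖y‖ ^ ((n : ℝ) / 2))⁻¹ *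
        (‖y‖ ^ ((n : ℝ) / 2) * b ^ (1 / 2 : ℝ) * c) := by field_simp
    _ ≤ _ := by gcongr
end
end
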